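/- If f : Z_k^n → Z_k has non-trivial essential arity gap, i.e. gap(f) ≥ 2, then every non-empty subset of the essential variables of f is a separable set in f. -/

import Mathlib

open scoped Classical

/-- Variable `i` is essential in `f`. -/
def Essential {n k : ℕ} (f : (Fin n → ZMod k) → ZMod k) (i : Fin n) : Prop :=
  ∃ a b : Fin n → ZMod k, (∀ j : Fin n, j ≠ i → a j = b j) ∧ f a ≠ f b

/-- The number of essential variables of `f`. -/
noncomputable def ess {n k : ℕ} (f : (Fin n → ZMod k) → ZMod k) : ℕ :=
  Nat.card {i : Fin n // Essential f i}

/-- The subfunction of `f` obtained by fixing the variables in `S` to the values given by `c`. -/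
def restrictF {n k : ℕ} (f : (Fin n → ZMod k) → ZMod k) (S : Finset (Fin n))
    (c : Fin n → ZMod k) : (Fin n → ZMod k) → ZMod k :=
  fun a => f (fun j => if j ∈ S then c j else a j)

/-- `M` is a separable set of variables in `f`: some subfunction of `f` has exactly `M`
as its set of essential variables. -/
def Separable {n k : ℕ} (f : (Fin n → ZMod k) → ZMod k) (M : Set (Fin n)) : Prop :=
  M.Nonempty ∧ ∃ (S : Finset (Fin n)) (c : Fin n → ZMod k),
    {i | Essential (restrictF f S c) i} = M

/-- The identification minor `f_{i←j}`: replace variable `x_i` by `x_j`. -/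
def ident {n k : ℕ} (f : (Fin n → ZMod k) → ZMod k) (i j : Fin n) :
    (Fin n → ZMod k) → ZMod k :=
  fun a => f (Function.update a i (a j))

/-- `h` is a simple identification minor of `f` (written `f ▷ h`). -/
def SimpleMinor {n k : ℕ} (f h : (Fin n → ZMod k) → ZMod k) : Prop :=
  ∃ i j : Fin n, i ≠ j ∧ Essential f i ∧ Essential f j ∧ h = ident f i j

/-- The essential arity gap of `f`. -/
noncomputable def gap {n k : ℕ} (f : (Fin n → ZMod k) → ZMod k) : ℕ :=
  ess f - sSup {m | ∃ h, SimpleMinor f h ∧ m = ess h}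


section helpers
variable {n k : ℕ}

noncomputable def EssSet (f : (Fin n → ZMod k) → ZMod k) : Finset (Fin n) :=
  Finset.univ.filter (fun i => Essential f i)

lemma mem_EssSet {f : (Fin n → ZMod k) → ZMod k} {i : Fin n} :
    i ∈ EssSet f ↔ Essential f i := by simp [EssSet]

lemma ess_eq_card (f : (Fin n → ZMod k) → ZMod k) : ess f = (EssSet f).card := by
  unfold ess EssSet
  rw [Nat.card_eq_fintype_card, Fintype.card_subtype]

lemma dep_aux (f : (Fin n → ZMod k) → ZMod k) (S : Finset (Fin n)) :
    (∀ i ∈ S, ¬ Essential f i) → ∀ x y : Fin n → ZMod k, (∀ i, i ∉ S → x i = y i) → f x = f y := by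
  induction S using Finset.induction_on with
  | empty =>
    intro _ x y h
    congr 1
    funext i
    exact h i (by simp)
  | insert a S ha ih =>
    intro hS x y h
    have h1 : f x = f (Function.update x a (y a)) := by
      by_contra hne
      apply hS a (by simp)
      exact ⟨x, Function.update x a (y a), fun j hj => by simp [hj], hne⟩
    rw [h1]
    apply ih (fun i hi => hS i (by simp [hi]))
    intro i hi
    by_cases hia : i = a
    · subst hia; simp
    · simp [hia]; exact h i (by simp [hia, hi])

lemma dep {f : (Fin n → ZMod k) → ZMod k} {x y : Fin n → ZMod k}
    (h : ∀ i, Essential f i → x i = y i) : f x = f y := by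
  apply dep_aux f (Finset.univ.filter (fun i => ¬ Essential f i))
  · intro i hi; simpa using hi
  · intro i hi; apply h; simpa using hi

lemma not_ess {f : (Fin n → ZMod k) → ZMod k} {i : Fin n}
    (h : ∀ x y : Fin n → ZMod k, (∀ j, j ≠ i → x j = y j) → f x = f y) : ¬ Essential f i := by
  rintro ⟨a, b, hab, hne⟩
  exact hne (h a b hab)

lemma comp_ess {G : (Fin n → ZMod k) → ZMod k} {s : Fin n → Fin n} {v : Fin n}
    (h : Essential (fun x => G (fun w => x (s w))) v) : ∃ w, s w = v ∧ Essential G w := by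
  obtain ⟨a, b, hab, hne⟩ := h
  by_contra hcon
  push Not at hcon
  apply hne
  apply dep
  intro i hi
  apply hab
  intro hs
  exact hcon i hs hi

lemma lemB {G T : (Fin n → ZMod k) → ZMod k} (s : Fin n → Fin n)
    (h : ∀ x, G (fun w => x (s w)) = T x) (hc : (EssSet G).card ≤ (EssSet T).card) :
    (∀ i j, Essential G i → Essential G j → s i = s j → i = j) ∧
    (∀ i, Essential G i → Essential T (s i)) ∧
    (∀ v, Essential T v → ∃ w, s w = v ∧ Essential G w) ∧
    (EssSet G).card = (EssSet T).card := by
  have hT : T = fun x => G (fun w => x (s w)) := by funext x; exact (h x).symm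
  have h3 : ∀ v, Essential T v → ∃ w, s w = v ∧ Essential G w := by
    intro v hv
    rw [hT] at hv
    exact comp_ess hv
  have hsub : EssSet T ⊆ (EssSet G).image s := by
    intro v hv
    obtain ⟨w, hw, hG⟩ := h3 v (mem_EssSet.1 hv)
    exact Finset.mem_image.2 ⟨w, mem_EssSet.2 hG, hw⟩
  have hle : ((EssSet G).image s).card ≤ (EssSet G).card := Finset.card_image_le
  have hle2 := Finset.card_le_card hsub
  have heq : EssSet T = (EssSet G).image s := Finset.eq_of_subset_of_card_le hsub (by omega)
  have hinj : Set.InjOn s (EssSet G) := Finset.card_image_iff.1 (by omega)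
  refine ⟨fun i j hi hj hs => hinj (mem_EssSet.2 hi) (mem_EssSet.2 hj) hs, ?_, h3, by omega⟩
  intro i hi
  rw [← mem_EssSet, heq]
  exact Finset.mem_image_of_mem s (mem_EssSet.2 hi)

lemma ident_eq {f : (Fin n → ZMod k) → ZMod k} {i j : Fin n} {x : Fin n → ZMod k}
    (h : x i = x j) : ident f i j x = f x := by
  unfold ident
  rw [← h, Function.update_eq_self]

lemma ident_not_ess {f : (Fin n → ZMod k) → ZMod k} {i j : Fin n} (hij : i ≠ j) :
    ¬ Essential (ident f i j) i := by
  apply not_ess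
  intro x y h
  unfold ident
  congr 1
  funext w
  by_cases hw : w = i
  · subst hw; simp; exact h j hij.symm
  · simp [hw]; exact h w hw

lemma ident_sub {f : (Fin n → ZMod k) → ZMod k} {i j : Fin n}
    (hj : Essential f j) {v : Fin n} (hv : Essential (ident f i j) v) : Essential f v := by
  have : ident f i j = fun x => f (fun w => x ((if w = i then j else w : Fin n))) := by
    funext x
    unfold ident
    congr 1
    funext w
    by_cases hw : w = i
    · subst hw; simp
    · simp [hw]
  rw [this] at hv
  obtain ⟨w, hw, hG⟩ := comp_ess hv
  split_ifs at hw
  · exact hw ▸ hj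
  · exact hw ▸ hG

lemma miss {f : (Fin n → ZMod k) → ZMod k} {i j v : Fin n} (hij : i ≠ j)
    (hv : ¬ Essential (ident f i j) v) {x y : Fin n → ZMod k} (hx : x i = x j) (hy : y i = y j)
    (h : ∀ w, w ≠ v → w ≠ i → x w = y w) : f x = f y := by
  rw [← ident_eq (f := f) hx, ← ident_eq (f := f) hy]
  apply dep
  intro w hw
  apply h
  · rintro rfl; exact hv hw
  · rintro rfl; exact ident_not_ess hij hw

/-- modify a tuple at four places -/
def t4 (a b c d : Fin n) (x : Fin n → ZMod k) (p q r s : ZMod k) : Fin n → ZMod k :=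
  fun w => if w = a then p else if w = b then q else if w = c then r else if w = d then s else x w

lemma caseI_core {f : (Fin n → ZMod k) → ZMod k} {a b c d : Fin n}
    (ha : Essential f a) (hb : Essential f b) (hc : Essential f c) (hd : Essential f d)
    (hab : a ≠ b) (hac : a ≠ c) (had : a ≠ d) (hbc : b ≠ c) (hbd : b ≠ d) (hcd : c ≠ d)
    (haT : Essential (ident f b a) a) (hcT : ¬ Essential (ident f b a) c)
    (hmax : ∀ i j, i ≠ j → Essential f i → Essential f j →
      (EssSet (ident f i j)).card ≤ (EssSet (ident f b a)).card) :
    (∀ x, (x a = x b ∨ x a = x c ∨ x b = x c) → f x = ident f b a x) ∨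
    (∀ x, (x a = x b ∨ x a = x c ∨ x b = x c) → f x = ident f a b x) := by
  have hbT : ¬ Essential (ident f b a) b := ident_not_ess hab.symm
  obtain ⟨θ, hθ⟩ : ∃ θ : (Fin n → ZMod k) → ZMod k → ZMod k → ZMod k,
      ∀ x p s, θ x p s = ident f b a (t4 a b c d x p p p s) := ⟨_, fun _ _ _ => rfl⟩
  have hT : ∀ x, ident f b a x = θ x (x a) (x d) := by
    intro x
    rw [hθ]
    apply dep
    intro i hi
    have : i ≠ b := by rintro rfl; exact hbT hi
    have : i ≠ c := by rintro rfl; exact hcT hi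
    simp only [t4]
    grind
  have hself : ∀ x : Fin n → ZMod k, t4 a b c d x (x a) (x b) (x c) (x d) = x := by
    intro x; funext w; simp only [t4]; grind
  have P12 : ∀ x p r s, f (t4 a b c d x p p r s) = θ x p s := by
    intro x p r s
    rw [hθ, ← ident_eq (i := b) (j := a) (f := f) (by simp only [t4]; grind)]
    apply dep
    intro i hi
    have : i ≠ b := by rintro rfl; exact hbT hi
    have : i ≠ c := by rintro rfl; exact hcT hi
    simp only [t4]
    grind
  -- not constant
  have hna : ¬ ∀ x p q s, s = p → θ x p s = θ x q s := by
    intro hcon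
    refine not_ess ?_ haT
    intro x y hxy
    rw [hT, hT, ← hcon x (x d) (x a) (x d) rfl, ← hcon y (y d) (y a) (y d) rfl, hθ, hθ]
    congr 1
    funext w
    have := hxy d had.symm
    have := hxy w
    simp only [t4]
    grind
  have D13 : (∀ x p q s, f (t4 a b c d x p q p s) = θ x p s) ∨
      (∀ x p q s, f (t4 a b c d x p q p s) = θ x q s) := by
    obtain ⟨h1, h2, h3, -⟩ := lemB (G := ident f c a) (T := ident f b a)
      (fun w => if w = b then a else w) (by
        intro x
        rw [hT, ← P12 x (x a) (x a) (x d)]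
        unfold ident
        congr 1
        funext w
        simp only [t4, Function.update_apply]
        grind) (hmax c a hac.symm hc ha)
    by_cases hea : Essential (ident f c a) a
    · left
      have heb : ¬ Essential (ident f c a) b := by
        intro h
        exact hab (h1 a b hea h (by simp))
      intro x p q s
      rw [← P12 x p p s]
      apply miss hac.symm heb <;> (simp only [t4]; grind)
    · right
      intro x p q s
      rw [← P12 x q q s]
      apply miss hac.symm hea <;> (simp only [t4]; grind)
  have D23 : (∀ x p q s, f (t4 a b c d x p q q s) = θ x p s) ∨
      (∀ x p q s, f (t4 a b c d x p q q s) = θ x q s) := by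
    obtain ⟨h1, h2, h3, -⟩ := lemB (G := ident f c b) (T := ident f b a)
      (fun w => if w = b then a else w) (by
        intro x
        rw [hT, ← P12 x (x a) (x a) (x d)]
        unfold ident
        congr 1
        funext w
        simp only [t4, Function.update_apply]
        grind) (hmax c b hbc.symm hc hb)
    by_cases hea : Essential (ident f c b) a
    · left
      have heb : ¬ Essential (ident f c b) b := by
        intro h
        exact hab (h1 a b hea h (by simp))
      intro x p q s
      rw [← P12 x p p s]
      apply miss hbc.symm heb <;> (simp only [t4]; grind)
    · right
      intro x p q s
      rw [← P12 x q q s]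
      apply miss hbc.symm hea <;> (simp only [t4]; grind)
  rcases D13 with P13 | P13 <;> rcases D23 with P23 | P23
  · -- projection on a
    left
    intro x hx
    rw [hT, ← hself x]
    rcases hx with hx | hx | hx
    · rw [← hx, P12]; simp [t4]; grind
    · rw [← hx, P13]; simp [t4]; grind
    · rw [← hx, P23]; simp [t4]; grind
  · -- majority
    exfalso
    obtain ⟨h1, h2, h3, -⟩ := lemB (G := ident f d a) (T := ident f b a)
      (fun w => if w = a then d else if w = b then a else if w = c then a else w) (by
        intro x
        rw [hT, ← P23 x (x d) (x a) (x d)]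
        unfold ident
        congr 1
        funext w
        simp only [t4, Function.update_apply]
        grind) (hmax d a had.symm hd ha)
    by_cases hec : Essential (ident f d a) c
    · have heb : ¬ Essential (ident f d a) b := by
        intro h
        exact hbc (h1 b c h hec (by simp [hab.symm, hac.symm]))
      apply hna
      rintro x p q s rfl
      rw [← P12 x s q s, ← P23 x s q s]
      apply miss had.symm heb <;> (simp only [t4]; grind)
    · apply hna
      rintro x p q s rfl
      rw [← P13 x s q s, ← P23 x s q s]
      apply miss had.symm hec <;> (simp only [t4]; grind)
  · -- minority
    exfalso
    obtain ⟨h1, h2, h3, -⟩ := lemB (G := ident f d a) (T := ident f b a)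
      (fun w => if w = a then d else if w = b then a else if w = c then d else w) (by
        intro x
        rw [hT, ← P13 x (x d) (x a) (x d)]
        unfold ident
        congr 1
        funext w
        simp only [t4, Function.update_apply]
        grind) (hmax d a had.symm hd ha)
    have hec : ¬ Essential (ident f d a) c := by
      intro hec
      have hea : ¬ Essential (ident f d a) a := by
        intro h
        exact hac (h1 a c h hec (by simp [hac.symm, hbc.symm]))
      have hdT : Essential (ident f b a) d := by
        have := h2 c hec
        simpa [hac.symm, hbc.symm] using this
      have key : ∀ x q r, θ x q r = θ x q q := by
        intro x q r
        rw [← P13 x r q r, ← P12 x q r q]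
        apply miss had.symm hea <;> (simp only [t4]; grind)
      refine not_ess ?_ hdT
      intro x y hxy
      rw [hT, hT, key x, key y, hθ, hθ]
      congr 1
      funext w
      have := hxy a had
      have := hxy w
      simp only [t4]
      grind
    apply hna
    rintro x p q s rfl
    rw [← P23 x s q s, ← P13 x s q s]
    apply miss had.symm hec <;> (simp only [t4]; grind)
  · right
    have hT' : ∀ x, ident f a b x = θ x (x b) (x d) := by
      intro x
      rw [← P12 x (x b) (x c) (x d)]
      unfold ident
      congr 1
      funext w
      simp only [t4, Function.update_apply]
      grind
    intro x hx
    rw [hT', ← hself x]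
    rcases hx with hx | hx | hx
    · rw [hx, P12]; simp [t4]; grind
    · rw [← hx, P13]; simp [t4]; grind
    · rw [← hx, P23]; simp [t4]; grind


/-- some essential variables of `f` get equal values in `x` -/
def HasRep (f : (Fin n → ZMod k) → ZMod k) (x : Fin n → ZMod k) : Prop :=
  ∃ i j : Fin n, i ≠ j ∧ Essential f i ∧ Essential f j ∧ x i = x j

lemma proj_step {f T : (Fin n → ZMod k) → ZMod k} {a b c m : Fin n}
    (hb : Essential f b) (hm : Essential f m)
    (hab : a ≠ b) (hac : a ≠ c) (hbc : b ≠ c) (hma : m ≠ a) (hmb : m ≠ b) (hmc : m ≠ c)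
    (haT : Essential T a) (hbT : ¬ Essential T b) (hcT : ¬ Essential T c)
    (hmax : ∀ i j, i ≠ j → Essential f i → Essential f j →
      (EssSet (ident f i j)).card ≤ (EssSet T).card)
    (P : ∀ x, (x a = x b ∨ x a = x c ∨ x b = x c) → f x = T x) :
    ∀ x, x b = x m → f x = T x := by
  have hdep : ∀ x y : Fin n → ZMod k, (∀ w, w ≠ b → w ≠ c → x w = y w) → T x = T y := by
    intro x y h
    apply dep
    intro i hi
    apply h
    · rintro rfl; exact hbT hi
    · rintro rfl; exact hcT hi
  obtain ⟨-, -, h3, -⟩ := lemB (G := ident f m b) (T := T)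
    (fun w => if w = b then m else if w = c then m else w) (by
      intro x
      unfold ident
      rw [P _ (by right; right; simp only [Function.update_apply]; grind)]
      apply hdep
      intro w hw hw'
      simp only [Function.update_apply]
      grind) (hmax m b hmb hm hb)
  obtain ⟨h1, -, -, -⟩ := lemB (G := ident f m b) (T := T)
    (fun w => if w = b then m else if w = c then a else w) (by
      intro x
      unfold ident
      rw [P _ (by right; left; simp only [Function.update_apply]; grind)]
      apply hdep
      intro w hw hw'
      simp only [Function.update_apply]
      grind) (hmax m b hmb hm hb)
  have hea : Essential (ident f m b) a := by
    obtain ⟨w, hw, hG⟩ := h3 a haT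
    grind
  have hec : ¬ Essential (ident f m b) c := by
    intro h
    have := h1 a c hea h (by grind)
    exact hac this
  intro x hx
  have e1 : f x = f (Function.update x c (x a)) := by
    apply miss hmb hec
    · exact hx.symm
    · simp only [Function.update_apply]; grind
    · simp only [Function.update_apply]; grind
  rw [e1, P _ (by right; left; simp only [Function.update_apply]; grind)]
  apply hdep
  simp only [Function.update_apply]
  grind

set_option maxHeartbeats 2000000 in
lemma proj_all {f T : (Fin n → ZMod k) → ZMod k} {a b c : Fin n}
    (ha : Essential f a) (hb : Essential f b) (hc : Essential f c)
    (hab : a ≠ b) (hac : a ≠ c) (hbc : b ≠ c)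
    (haT : Essential T a) (hbT : ¬ Essential T b) (hcT : ¬ Essential T c)
    (hmax : ∀ i j, i ≠ j → Essential f i → Essential f j →
      (EssSet (ident f i j)).card ≤ (EssSet T).card)
    (hmiss : ∀ i j, i ≠ j → Essential f i → Essential f j →
      ∃ v, Essential f v ∧ v ≠ i ∧ ¬ Essential (ident f i j) v)
    (P : ∀ x, (x a = x b ∨ x a = x c ∨ x b = x c) → f x = T x) :
    ∀ x, HasRep f x → f x = T x := by
  have hdep : ∀ x y : Fin n → ZMod k, (∀ w, w ≠ b → w ≠ c → x w = y w) → T x = T y := by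
    intro x y h
    apply dep
    intro i hi
    apply h
    · rintro rfl; exact hbT hi
    · rintro rfl; exact hcT hi
  have Qb : ∀ m, Essential f m → m ≠ b → ∀ x, x b = x m → f x = T x := by
    intro m hm hmb x hx
    by_cases hma : m = a
    · subst hma; exact P x (Or.inl hx.symm)
    by_cases hmc : m = c
    · subst hmc; exact P x (Or.inr (Or.inr hx))
    exact proj_step hb hm hab hac hbc hma hmb hmc haT hbT hcT hmax P x hx
  have Qc : ∀ m, Essential f m → m ≠ c → ∀ x, x c = x m → f x = T x := by
    intro m hm hmc x hx
    by_cases hma : m = a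
    · subst hma; exact P x (Or.inr (Or.inl hx.symm))
    by_cases hmb : m = b
    · subst hmb; exact P x (Or.inr (Or.inr hx.symm))
    refine proj_step hc hm hac hab hbc.symm hma hmc hmb haT hcT hbT hmax ?_ x hx
    intro y hy
    apply P
    rcases hy with h | h | h
    · exact Or.inr (Or.inl h)
    · exact Or.inl h
    · exact Or.inr (Or.inr h.symm)
  rintro x ⟨i, j, hij, hi, hj, hx⟩
  by_cases hib : i = b
  · subst hib; exact Qb j hj hij.symm x hx
  by_cases hic : i = c
  · subst hic; exact Qc j hj hij.symm x hx
  by_cases hjb : j = b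
  · subst hjb; exact Qb i hi hij x hx.symm
  by_cases hjc : j = c
  · subst hjc; exact Qc i hi hij x hx.symm
  have hor : ¬ Essential (ident f i j) b ∨ ¬ Essential (ident f i j) c := by
    obtain ⟨v, hv, hvi, hvG⟩ := hmiss i j hij hi hj
    by_cases hvb : v = b
    · subst hvb; exact Or.inl hvG
    by_cases hvc : v = c
    · subst hvc; exact Or.inr hvG
    left
    have key : ∀ y : Fin n → ZMod k, y i = y j →
        f y = T (fun w => if w = v ∨ (v = j ∧ w = i) then y c else y w) := by
      intro y hy
      rw [← Qc v hv hvc (fun w => if w = v ∨ (v = j ∧ w = i) then y c else y w) (by grind)]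
      apply miss hij hvG hy <;> grind
    apply not_ess
    intro y z hyz
    unfold ident
    rw [key _ (by simp only [Function.update_apply]; grind),
      key _ (by simp only [Function.update_apply]; grind)]
    apply hdep
    intro w hwb hwc
    have h1 := hyz w hwb
    have h2 := hyz c hbc.symm
    have h3 := hyz j hjb
    clear hmiss hmax P Qb Qc key hdep hyz
    simp only [Function.update_apply]
    grind
  clear hmiss hmax Qb Qc
  rcases hor with h | h
  · have e1 : f x = f (Function.update x b (x c)) := by
      apply miss hij h hx <;> simp only [Function.update_apply] <;> grind
    rw [e1, P _ (by right; right; simp only [Function.update_apply]; grind)]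
    apply hdep
    simp only [Function.update_apply]
    grind
  · have e1 : f x = f (Function.update x c (x b)) := by
      apply miss hij h hx <;> simp only [Function.update_apply] <;> grind
    rw [e1, P _ (by right; right; simp only [Function.update_apply]; grind)]
    apply hdep
    simp only [Function.update_apply]
    grind

lemma exists_miss {f : (Fin n → ZMod k) → ZMod k} {G : (Fin n → ZMod k) → ZMod k} (i : Fin n)
    (h : (EssSet G).card + 2 ≤ (EssSet f).card) :
    ∃ v, Essential f v ∧ v ≠ i ∧ ¬ Essential G v := by
  have : (insert i (EssSet G)).card < (EssSet f).card :=
    lt_of_le_of_lt (Finset.card_insert_le _ _) (by omega)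
  obtain ⟨v, hv, hv'⟩ := Finset.exists_mem_notMem_of_card_lt_card this
  simp only [Finset.mem_insert, mem_EssSet, not_or] at hv hv'
  exact ⟨v, hv, hv'⟩

lemma caseI {f : (Fin n → ZMod k) → ZMod k} {a b : Fin n}
    (ha : Essential f a) (hb : Essential f b) (hab : a ≠ b)
    (h4 : 4 ≤ (EssSet f).card)
    (hg : ∀ i j, i ≠ j → Essential f i → Essential f j →
      (EssSet (ident f i j)).card + 2 ≤ (EssSet f).card)
    (haT : Essential (ident f b a) a)
    (hmax : ∀ i j, i ≠ j → Essential f i → Essential f j →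
      (EssSet (ident f i j)).card ≤ (EssSet (ident f b a)).card) :
    ∃ T : (Fin n → ZMod k) → ZMod k, (EssSet T).card + 2 ≤ (EssSet f).card ∧
      ∀ x, HasRep f x → f x = T x := by
  obtain ⟨c, hc, hcb, hcT⟩ := exists_miss b (hg b a hab.symm hb ha)
  have hca : c ≠ a := by rintro rfl; exact hcT haT
  have hd : ∃ d, d ∈ EssSet f ∧ d ∉ ({a, b, c} : Finset (Fin n)) :=
    Finset.exists_mem_notMem_of_card_lt_card (lt_of_le_of_lt Finset.card_le_three (by omega))
  obtain ⟨d, hd, hd'⟩ := hd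
  simp only [Finset.mem_insert, Finset.mem_singleton, not_or] at hd'
  obtain ⟨hda, hdb, hdc⟩ := hd'
  have hmiss : ∀ i j, i ≠ j → Essential f i → Essential f j →
      ∃ v, Essential f v ∧ v ≠ i ∧ ¬ Essential (ident f i j) v :=
    fun i j hij hi hj => exists_miss i (hg i j hij hi hj)
  rcases caseI_core ha hb hc (mem_EssSet.1 hd) hab hca.symm (Ne.symm hda) hcb.symm (Ne.symm hdb)
    (Ne.symm hdc) haT hcT hmax with P | P
  · exact ⟨ident f b a, hg b a hab.symm hb ha,
      proj_all ha hb hc hab hca.symm hcb.symm haT (ident_not_ess hab.symm) hcT hmax hmiss P⟩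
  · obtain ⟨-, h2, h3, h5⟩ := lemB (G := ident f a b) (T := ident f b a)
      (fun w => if w = b then a else w) (by
        intro x
        unfold ident
        congr 1
        funext w
        simp only [Function.update_apply]
        grind) (hmax a b hab ha hb)
    have haT' : ¬ Essential (ident f a b) a := ident_not_ess hab
    have hbT' : Essential (ident f a b) b := by
      obtain ⟨w, hw, hG⟩ := h3 a haT
      grind
    have hcT' : ¬ Essential (ident f a b) c := by
      intro h
      have := h2 c h
      simp only [hcb, if_false] at this
      exact hcT this
    refine ⟨ident f a b, hg a b hab ha hb, 
      proj_all hb ha hc hab.symm hcb.symm hca.symm hbT' haT' hcT' ?_ hmiss ?_⟩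
    · intro i j hij hi hj
      rw [h5]; exact hmax i j hij hi hj
    · intro x hx
      apply P
      rcases hx with h | h | h
      · exact Or.inl h.symm
      · exact Or.inr (Or.inr h)
      · exact Or.inr (Or.inl h)

lemma sep_of {f : (Fin n → ZMod k) → ZMod k} {M : Set (Fin n)} (hM : M.Nonempty)
    (c : Fin n → ZMod k)
    (h : ∀ i ∈ M, ∃ x y : Fin n → ZMod k, (∀ w, w ∉ M → x w = c w) ∧
      (∀ w, w ≠ i → x w = y w) ∧ f x ≠ f y) : Separable f M := by
  refine ⟨hM, Finset.univ.filter (fun w => w ∉ M), c, ?_⟩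
  ext i
  simp only [Set.mem_ofPred_eq]
  constructor
  · intro hi
    by_contra hiM
    refine not_ess ?_ hi
    intro x y hxy
    unfold restrictF
    congr 1
    funext w
    by_cases hw : w ∈ M
    · simp only [Finset.mem_filter, Finset.mem_univ, true_and, hw, not_true, if_false]
      apply hxy
      rintro rfl
      exact hiM hw
    · simp [hw]
  · intro hi
    obtain ⟨x, y, h1, h2, h3⟩ := h i hi
    refine ⟨x, y, h2, ?_⟩
    have e : ∀ z : Fin n → ZMod k, (∀ w, w ∉ M → z w = c w) →
        restrictF f (Finset.univ.filter (fun w => w ∉ M)) c z = f z := by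
      intro z hz
      unfold restrictF
      congr 1
      funext w
      by_cases hw : w ∈ M
      · simp [hw]
      · simp [hw, hz w hw]
    rw [e x h1, e y ?_]
    · exact h3
    · intro w hw
      rw [← h2 w (by rintro rfl; exact hw hi), h1 w hw]

lemma nonsep {f : (Fin n → ZMod k) → ZMod k} {M : Set (Fin n)} (hM : M.Nonempty)
    (hs : ¬ Separable f M) (c : Fin n → ZMod k) :
    ∃ i ∈ M, ∀ x y : Fin n → ZMod k, (∀ w, w ∉ M → x w = c w) →
      (∀ w, w ≠ i → x w = y w) → f x = f y := by
  by_contra hcon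
  push Not at hcon
  exact hs (sep_of hM c hcon)

lemma sep_quasi {f T : (Fin n → ZMod k) → ZMod k} (h3 : 3 ≤ (EssSet f).card)
    (hT : (EssSet T).card + 2 ≤ (EssSet f).card) (hR : ∀ x, HasRep f x → f x = T x)
    {M : Set (Fin n)} (hM : M.Nonempty) (hME : ∀ i ∈ M, Essential f i) : Separable f M := by
  by_contra hs
  obtain ⟨t, ht⟩ : ∃ t, f t ≠ T t := by
    by_contra hcon
    push Not at hcon
    have : f = T := funext hcon
    subst this
    omega
  have tdep : ∀ {v}, ¬ Essential T v → ∀ x y : Fin n → ZMod k,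
      (∀ w, w ≠ v → x w = y w) → T x = T y := by
    intro v hv x y h
    by_contra hne
    exact hv ⟨x, y, h, hne⟩
  obtain ⟨i, hiM, hi⟩ := nonsep hM hs t
  by_cases hiT : Essential T i
  swap
  · obtain ⟨j, hj, hji⟩ := Finset.exists_mem_ne (s := EssSet f) (by omega) i
    rw [mem_EssSet] at hj
    apply ht
    rw [hi t (Function.update t i (t j)) (fun _ _ => rfl) (by simp only [Function.update_apply]; grind),
      hR _ ⟨i, j, hji.symm, hME i hiM, hj, by simp only [Function.update_apply]; grind⟩]
    apply tdep hiT
    simp only [Function.update_apply]; grind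
  by_cases hl : ∃ l ∈ M, ¬ Essential T l
  · obtain ⟨l, hlM, hlT⟩ := hl
    have hil : i ≠ l := by rintro rfl; exact hlT hiT
    obtain ⟨j, hj, hj'⟩ : ∃ j, j ∈ EssSet f ∧ j ∉ ({i, l} : Finset (Fin n)) :=
      Finset.exists_mem_notMem_of_card_lt_card (lt_of_le_of_lt Finset.card_le_two (by omega))
    rw [mem_EssSet] at hj
    simp only [Finset.mem_insert, Finset.mem_singleton, not_or] at hj'
    obtain ⟨hji, hjl⟩ := hj'
    apply ht
    have e1 : f t = f (Function.update t i (t j)) :=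
      hi _ _ (fun _ _ => rfl) (by simp only [Function.update_apply]; grind)
    have e2 : f (Function.update t i (t j)) = T (Function.update t i (t j)) :=
      hR _ ⟨i, j, Ne.symm hji, hME i hiM, hj, by simp only [Function.update_apply]; grind⟩
    have e3 : T (Function.update t i (t j)) = T (Function.update (Function.update t i (t j)) l (t i)) := by
      apply tdep hlT
      simp only [Function.update_apply]; grind
    have e4 : f (Function.update (Function.update t i (t j)) l (t i)) =
        T (Function.update (Function.update t i (t j)) l (t i)) :=
      hR _ ⟨i, j, Ne.symm hji, hME i hiM, hj, by simp only [Function.update_apply]; grind⟩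
    have e5 : f (Function.update t l (t i)) = f (Function.update (Function.update t i (t j)) l (t i)) := by
      apply hi
      · simp only [Function.update_apply]; grind
      · simp only [Function.update_apply]; grind
    have e6 : f (Function.update t l (t i)) = T (Function.update t l (t i)) :=
      hR _ ⟨i, l, hil, hME i hiM, hME l hlM, by simp only [Function.update_apply]; grind⟩
    have e7 : T (Function.update t l (t i)) = T t := by
      apply tdep hlT
      simp only [Function.update_apply]; grind
    rw [e1, e2, e3, ← e4, ← e5, e6, e7]
  · push Not at hl
    obtain ⟨l, hlE, -, hlT⟩ := exists_miss i hT
    obtain ⟨l', hlE', hll, hlT'⟩ := exists_miss l hT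
    have hlM : l ∉ M := fun h => hlT (hl l h)
    have hlM' : l' ∉ M := fun h => hlT' (hl l' h)
    obtain ⟨j, hjM, hj⟩ := nonsep hM hs (Function.update t l' (t l))
    have hjT : ∀ x y : Fin n → ZMod k, (∀ w, w ∉ M → x w = t w) →
      (∀ w, w ≠ j → x w = y w) → T x = T y := by
      intro x y hx hxy
      have hjl : j ≠ l := by rintro rfl; exact hlM hjM
      have hjl' : j ≠ l' := by rintro rfl; exact hlM' hjM
      have f1 := hj (Function.update x l' (t l)) (Function.update y l' (t l))
        (by simp only [Function.update_apply]; grind) (by simp only [Function.update_apply]; grind)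
      have hxl := hx l hlM
      have hyl := hxy l hjl.symm
      rw [hR _ ⟨l', l, hll, hlE', hlE, by simp only [Function.update_apply]; grind⟩,
        hR _ ⟨l', l, hll, hlE', hlE, by simp only [Function.update_apply]; grind⟩] at f1
      rw [tdep hlT' x (Function.update x l' (t l)) (by simp only [Function.update_apply]; grind), f1]
      apply tdep hlT'
      simp only [Function.update_apply]; grind
    have hil : i ≠ l := by rintro rfl; exact hlM hiM
    have hjl : j ≠ l := by rintro rfl; exact hlM hjM
    have e1 : f t = f (Function.update t i (t l)) :=
      hi _ _ (fun _ _ => rfl) (by simp only [Function.update_apply]; grind)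
    have e2 : f (Function.update t i (t l)) = T (Function.update t i (t l)) :=
      hR _ ⟨i, l, hil, hME i hiM, hlE, by simp only [Function.update_apply]; grind⟩
    apply ht
    by_cases hij : j = i
    · subst hij
      rw [e1, e2]
      apply hjT <;> (simp only [Function.update_apply]; grind)
    · have e3 : T t = T (Function.update t j (t l)) := by
        apply hjT <;> (simp only [Function.update_apply]; grind)
      have e4 : f (Function.update t j (t l)) = T (Function.update t j (t l)) :=
        hR _ ⟨j, l, hjl, hME j hjM, hlE, by simp only [Function.update_apply]; grind⟩
      have e5 : f (Function.update t j (t l)) =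
          f (Function.update (Function.update t j (t l)) i (t l)) := by
        apply hi <;> (simp only [Function.update_apply]; grind)
      have e6 : f (Function.update (Function.update t j (t l)) i (t l)) =
          T (Function.update (Function.update t j (t l)) i (t l)) :=
        hR _ ⟨j, l, hjl, hME j hjM, hlE, by simp only [Function.update_apply]; grind⟩
      have e7 : T (Function.update (Function.update t j (t l)) i (t l)) =
          T (Function.update t i (t l)) := by
        apply hjT <;> (simp only [Function.update_apply]; grind)
      rw [e1, e2, e3, ← e4, e5, e6, e7]

lemma caseII_step {f : (Fin n → ZMod k) → ZMod k} {N : ℕ} (hN : 0 < N)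
    (hmax : ∀ i j, i ≠ j → Essential f i → Essential f j → (EssSet (ident f i j)).card ≤ N)
    (hII : ∀ i j, i ≠ j → Essential f i → Essential f j → (EssSet (ident f i j)).card = N →
      ¬ Essential (ident f i j) j)
    {a b : Fin n} (ha : Essential f a) (hb : Essential f b) (hab : a ≠ b)
    (hba : (EssSet (ident f b a)).card = N) :
    ∀ c, Essential f c → c ≠ a → c ≠ b → (EssSet (ident f c a)).card = N ∧
      (EssSet (ident f c b)).card = N := by
  have hbT : ¬ Essential (ident f b a) b := ident_not_ess hab.symm
  have haT : ¬ Essential (ident f b a) a := hII b a hab.symm hb ha hba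
  have hT : ∀ x y : Fin n → ZMod k, y a = y b → (∀ w, w ≠ a → w ≠ b → y w = x w) →
      f y = ident f b a x := by
    intro x y hy h
    rw [← ident_eq (f := f) hy.symm]
    apply dep
    intro i hi
    apply h
    · rintro rfl; exact haT hi
    · rintro rfl; exact hbT hi
  have A : ∀ c, Essential f c → Essential (ident f b a) c → c ≠ a → c ≠ b →
      (EssSet (ident f c a)).card = N ∧ (EssSet (ident f c b)).card = N := by
    intro c hc hcT hca hcb
    constructor
    · rw [← hba]
      refine (lemB (G := ident f c a) (T := ident f b a)
        (fun w => if w = a then c else if w = b then c else w) ?_ ?_).2.2.2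
      · intro x
        apply hT <;> (simp only [Function.update_apply]; grind)
      · rw [hba]; exact hmax c a hca hc ha
    · rw [← hba]
      refine (lemB (G := ident f c b) (T := ident f b a)
        (fun w => if w = a then c else if w = b then c else w) ?_ ?_).2.2.2
      · intro x
        apply hT <;> (simp only [Function.update_apply]; grind)
      · rw [hba]; exact hmax c b hcb hc hb
  intro d hd hda hdb
  by_cases hdT : Essential (ident f b a) d
  · exact A d hd hdT hda hdb
  exfalso
  obtain ⟨c, hcT⟩ : (EssSet (ident f b a)).Nonempty := by
    rw [← Finset.card_pos]; omega
  rw [mem_EssSet] at hcT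
  have hc := ident_sub ha hcT
  have hca : c ≠ a := by rintro rfl; exact haT hcT
  have hcb : c ≠ b := by rintro rfl; exact hbT hcT
  have hcd : c ≠ d := by rintro rfl; exact hdT hcT
  have hG' := hII c b hcb hc hb (A c hc hcT hca hcb).2
  obtain ⟨-, h2, -, -⟩ := lemB (G := ident f d a) (T := ident f b a)
    (fun w => if w = b then a else w) (by
      intro x
      · have : ident f b a (Function.update x d (x a)) = ident f b a x := by
          apply dep
          intro i hi
          have : i ≠ d := by rintro rfl; exact hdT hi
          simp [this]
        rw [← this]
        apply hT <;> (simp only [Function.update_apply]; grind)) (by rw [hba]; exact hmax d a hda hd ha)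
  have hbH : ¬ Essential (ident f d a) b := by
    intro h
    have := h2 b h
    simp only [if_true] at this
    exact haT this
  have key : ∀ x : Fin n → ZMod k, ident f b a x = ident f b a (Function.update x c (x a)) := by
    intro x
    have e0 : ident f b a x = ident f b a (Function.update x d (x a)) := by
      apply dep
      intro i hi
      have : i ≠ d := by rintro rfl; exact hdT hi
      simp [this]
    have e1 : ident f b a (Function.update (Function.update x c (x a)) d (x a)) =
        ident f b a (Function.update x c (x a)) := by
      apply dep
      intro i hi
      have : i ≠ d := by rintro rfl; exact hdT hi
      simp [this]
    have e2 : f (t4 a b c d x (x a) (x a) (x c) (x a)) = f (t4 a b c d x (x a) (x c) (x c) (x a)) := by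
      apply miss hda hbH <;> (simp only [t4]; grind)
    have e3 : f (t4 a b c d x (x a) (x c) (x c) (x a)) = f (t4 a b c d x (x a) (x a) (x a) (x a)) := by
      apply miss hcb hG' <;> (simp only [t4]; grind)
    rw [e0, ← e1, ← hT (Function.update x d (x a)) (t4 a b c d x (x a) (x a) (x c) (x a))
      (by simp only [t4]; grind) (by simp only [t4, Function.update_apply]; grind), e2, e3]
    apply hT <;> (simp only [t4, Function.update_apply]; grind)
  refine not_ess ?_ hcT
  intro x y hxy
  rw [key x, key y]
  congr 1
  funext w
  have := hxy a hca.symm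
  have := hxy w
  simp only [Function.update_apply]
  grind

lemma caseII_all {f : (Fin n → ZMod k) → ZMod k} {N : ℕ} (hN : 0 < N)
    (hmax : ∀ i j, i ≠ j → Essential f i → Essential f j → (EssSet (ident f i j)).card ≤ N)
    (hII : ∀ i j, i ≠ j → Essential f i → Essential f j → (EssSet (ident f i j)).card = N →
      ¬ Essential (ident f i j) j)
    {a b : Fin n} (ha : Essential f a) (hb : Essential f b) (hab : a ≠ b)
    (hba : (EssSet (ident f b a)).card = N) :
    ∀ i j, i ≠ j → Essential f i → Essential f j → ¬ Essential (ident f i j) j := by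
  have symm : ∀ i j, i ≠ j → Essential f i → Essential f j → (EssSet (ident f i j)).card = N →
      (EssSet (ident f j i)).card = N := by
    intro i j hij hi hj h
    have h1 := hII i j hij hi hj h
    have : ident f j i = ident f i j := by
      funext x
      have : ident f j i x = f (Function.update x j (x i)) := rfl
      rw [this, ← ident_eq (f := f) (i := i) (j := j) (by simp [hij])]
      apply dep
      intro w hw
      have : w ≠ j := by rintro rfl; exact h1 hw
      simp [this]
    rw [this, h]
  have hA : ∀ c, Essential f c → c ≠ a → (EssSet (ident f c a)).card = N := by
    intro c hc hca
    by_cases hcb : c = b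
    · subst hcb; exact hba
    · exact (caseII_step hN hmax hII ha hb hab hba c hc hca hcb).1
  intro i j hij hi hj
  apply hII i j hij hi hj
  by_cases hja : j = a
  · subst hja; exact hA i hi hij
  by_cases hia : i = a
  · subst hia; exact symm j i hij.symm hj hi (hA j hj hij.symm)
  exact (caseII_step hN hmax hII ha hj (Ne.symm hja) (hA j hj hja) i hi hia hij).2

lemma swap_inv {f : (Fin n → ZMod k) → ZMod k}
    (hall : ∀ i j, i ≠ j → Essential f i → Essential f j → ¬ Essential (ident f i j) j)
    {i j : Fin n} (hi : Essential f i) (hj : Essential f j)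
    {x : Fin n → ZMod k} (hx : HasRep f x) : f (fun w => x (Equiv.swap i j w)) = f x := by
  have move : ∀ p q, p ≠ q → Essential f p → Essential f q → ∀ x y : Fin n → ZMod k,
      x p = x q → y p = y q → (∀ w, w ≠ p → w ≠ q → x w = y w) → f x = f y := by
    intro p q hpq hp hq x y h1 h2 h3
    exact miss hpq (hall p q hpq hp hq) h1 h2 (fun w hw hw' => h3 w hw' hw)
  by_cases hij : i = j
  · subst hij; simp
  have key1 : ∀ i j b, i ≠ j → b ≠ i → b ≠ j → Essential f i → Essential f j → Essential f b →
      ∀ x : Fin n → ZMod k, x i = x b → f (fun w => x (Equiv.swap i j w)) = f x := by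
    intro i j b hij hbi hbj hi hj hb x hx
    rw [move i b hbi.symm hi hb x (fun w => if w = i ∨ w = b then x j else x w) hx (by grind)
      (by grind)]
    symm
    apply move j b hbj.symm hj hb
    · grind
    · simp only [Equiv.swap_apply_def]; grind
    · simp only [Equiv.swap_apply_def]; grind
  obtain ⟨a, b, hab, ha, hb, hx⟩ := hx
  by_cases hai : a = i
  · subst hai
    by_cases hbj : b = j
    · subst hbj
      congr 1
      funext w
      simp only [Equiv.swap_apply_def]; grind
    · exact key1 a j b hij hab.symm hbj ha hj hb x hx
  by_cases haj : a = j
  · subst haj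
    by_cases hbi : b = i
    · subst hbi
      congr 1
      funext w
      simp only [Equiv.swap_apply_def]; grind
    · rw [Equiv.swap_comm]
      exact key1 a i b (Ne.symm hij) hab.symm hbi ha hi hb x hx
  by_cases hbi : b = i
  · subst hbi
    exact key1 b j a hij hai haj hb hj ha x hx.symm
  by_cases hbj : b = j
  · subst hbj
    rw [Equiv.swap_comm]
    exact key1 b i a (Ne.symm hij) haj hai hb hi ha x hx.symm
  -- all distinct
  have e0 : x = t4 i j a b x (x i) (x j) (x a) (x a) := by
    funext w; simp only [t4]; grind
  have e5 : (fun w => x (Equiv.swap i j w)) = t4 i j a b x (x j) (x i) (x a) (x a) := by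
    funext w; simp only [t4, Equiv.swap_apply_def]; grind
  have e1 : f (t4 i j a b x (x i) (x j) (x a) (x a)) = f (t4 i j a b x (x i) (x j) (x i) (x i)) := by
    apply move a b hab ha hb <;> (simp only [t4]; grind)
  have e2 : f (t4 i j a b x (x i) (x j) (x i) (x i)) = f (t4 i j a b x (x j) (x j) (x j) (x i)) := by
    apply move i a (Ne.symm hai) hi ha <;> (simp only [t4]; grind)
  have e3 : f (t4 i j a b x (x j) (x j) (x j) (x i)) = f (t4 i j a b x (x j) (x i) (x i) (x i)) := by
    apply move j a (Ne.symm haj) hj ha <;> (simp only [t4]; grind)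
  have e4 : f (t4 i j a b x (x j) (x i) (x i) (x i)) = f (t4 i j a b x (x j) (x i) (x a) (x a)) := by
    apply move a b hab ha hb <;> (simp only [t4]; grind)
  calc f (fun w => x (Equiv.swap i j w)) = f (t4 i j a b x (x j) (x i) (x a) (x a)) := by rw [e5]
    _ = f (t4 i j a b x (x i) (x j) (x a) (x a)) := by rw [e1, e2, e3, e4]
    _ = f x := by rw [← e0]

lemma hasRep_swap {f : (Fin n → ZMod k) → ZMod k} {i j : Fin n} (hi : Essential f i)
    (hj : Essential f j) {x : Fin n → ZMod k} (hx : HasRep f x) :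
    HasRep f (fun w => x (Equiv.swap i j w)) := by
  obtain ⟨a, b, hab, ha, hb, hx⟩ := hx
  have he : ∀ a, Essential f a → Essential f (Equiv.swap i j a) := by
    intro a ha
    rw [Equiv.swap_apply_def]
    split_ifs <;> assumption
  exact ⟨Equiv.swap i j a, Equiv.swap i j b, fun h => hab ((Equiv.swap i j).injective h),
    he a ha, he b hb, by simpa using hx⟩

lemma sep_sym {f : (Fin n → ZMod k) → ZMod k}
    (hall : ∀ i j, i ≠ j → Essential f i → Essential f j → ¬ Essential (ident f i j) j)
    {t : Fin n} (ht : Essential f t) {x y : Fin n → ZMod k} (hx : HasRep f x) (hy : HasRep f y)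
    (hxy : ∀ w, w ≠ t → x w = y w) (hne : f x ≠ f y)
    {M : Set (Fin n)} (hM : M.Nonempty) (hME : ∀ i ∈ M, Essential f i) : Separable f M := by
  obtain ⟨i₀, hi₀⟩ := hM
  have h0 := hME i₀ hi₀
  refine sep_of ⟨i₀, hi₀⟩ (fun w => x (Equiv.swap t i₀ w)) ?_
  intro i hi
  refine ⟨fun w => x (Equiv.swap t i₀ (Equiv.swap i₀ i w)),
    fun w => y (Equiv.swap t i₀ (Equiv.swap i₀ i w)), ?_, ?_, ?_⟩
  · intro w hw
    have h1 : w ≠ i₀ := by rintro rfl; exact hw hi₀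
    have h2 : w ≠ i := by rintro rfl; exact hw hi
    simp only [Equiv.swap_apply_of_ne_of_ne h1 h2]
  · intro w hw
    apply hxy
    simp only [Equiv.swap_apply_def]; grind
  · have e1 := swap_inv hall h0 (hME i hi) (hasRep_swap ht h0 hx)
    have e2 := swap_inv hall h0 (hME i hi) (hasRep_swap ht h0 hy)
    rw [e1, e2, swap_inv hall ht h0 hx, swap_inv hall ht h0 hy]
    exact hne

lemma sep_three {f : (Fin n → ZMod k) → ZMod k} {p q r : Fin n}
    (hpq : p ≠ q) (hpr : p ≠ r) (hqr : q ≠ r)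
    (hE : ∀ i, Essential f i ↔ i = p ∨ i = q ∨ i = r)
    (hg : (EssSet (ident f r p)).card ≤ 1) : Separable f {p, q} := by
  by_contra hs
  have hM : ({p, q} : Set (Fin n)).Nonempty := ⟨p, by simp⟩
  obtain ⟨a, b, hab, hne⟩ := (hE p).2 (by simp)
  obtain ⟨a', b', hab', hne'⟩ := (hE q).2 (by simp)
  obtain ⟨i, hi, h1⟩ := nonsep hM hs a
  obtain ⟨j, hj, h2⟩ := nonsep hM hs a'
  have hiq : i = q := by
    rcases hi with rfl | hi
    · exact absurd (h1 a b (fun _ _ => rfl) hab) hne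
    · exact hi
  have hjp : j = p := by
    rcases hj with hj | hj
    · exact hj
    · rw [Set.mem_singleton_iff] at hj
      subst hj
      exact absurd (h2 a' b' (fun _ _ => rfl) hab') hne'
  subst hiq hjp
  clear hi hj
  obtain ⟨H, hH⟩ : ∃ H : ZMod k → ZMod k → ZMod k → ZMod k,
      ∀ x, f x = H (x j) (x i) (x r) := by
    refine ⟨fun u v w => f (t4 j i r r a u v w w), ?_⟩
    intro x
    apply dep
    intro w hw
    rw [hE] at hw
    simp only [t4]; grind
  have I1 : ∀ u v v', H u v (a r) = H u v' (a r) := by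
    intro u v v'
    have := h1 (t4 j i r r a u v (a r) (a r)) (t4 j i r r a u v' (a r) (a r))
      (by intro w hw; simp only [Set.mem_insert_iff, Set.mem_singleton_iff] at hw; simp only [t4]; grind)
      (by simp only [t4]; grind)
    rw [hH, hH] at this
    simpa [t4, hpq, hpr, hqr, hpq.symm, hpr.symm, hqr.symm] using this
  have I2 : ∀ u u' v, H u v (a' r) = H u' v (a' r) := by
    intro u u' v
    have := h2 (t4 j i r r a' u v (a' r) (a' r)) (t4 j i r r a' u' v (a' r) (a' r))
      (by intro w hw; simp only [Set.mem_insert_iff, Set.mem_singleton_iff] at hw; simp only [t4]; grind)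
      (by simp only [t4]; grind)
    rw [hH, hH] at this
    simpa [t4, hpq, hpr, hqr, hpq.symm, hpr.symm, hqr.symm] using this
  apply hne'
  rw [hH, hH b', ← hab' j hpq, ← hab' r hqr.symm, I2 (a' j) (a' r), I2 (a' j) (a' r)]
  by_cases hj : Essential (ident f r j) j
  · have hi : ¬ Essential (ident f r j) i := by
      intro h
      exact hpq (Finset.card_le_one.1 hg j (mem_EssSet.2 hj) i (mem_EssSet.2 h))
    have := miss hpr.symm hi (x := t4 j i r r a (a' r) (a' i) (a' r) (a' r))
      (y := t4 j i r r a (a' r) (b' i) (a' r) (a' r)) (by simp only [t4]; grind)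
      (by simp only [t4]; grind) (by simp only [t4]; grind)
    rw [hH, hH] at this
    simpa [t4, hpq, hpr, hqr, hpq.symm, hpr.symm, hqr.symm] using this
  · have : ∀ u u' v, H u v u = H u' v u' := by
      intro u u' v
      have := miss hpr.symm hj (x := t4 j i r r a u v u u)
        (y := t4 j i r r a u' v u' u') (by simp only [t4]; grind)
        (by simp only [t4]; grind) (by simp only [t4]; grind)
      rw [hH, hH] at this
      simpa [t4, hpq, hpr, hqr, hpq.symm, hpr.symm, hqr.symm] using this
    rw [this (a' r) (a r), this (a' r) (a r)]
    exact I1 _ _ _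

lemma sep_four {f : (Fin n → ZMod k) → ZMod k} (h4 : 4 ≤ (EssSet f).card)
    (hg : ∀ i j, i ≠ j → Essential f i → Essential f j →
      (EssSet (ident f i j)).card + 2 ≤ (EssSet f).card)
    {M : Set (Fin n)} (hM : M.Nonempty) (hME : ∀ i ∈ M, Essential f i) : Separable f M := by
  obtain ⟨p0, hp0, q0, hq0, hpq0⟩ := Finset.one_lt_card.1 (show 1 < (EssSet f).card by omega)
  let P : Finset (Fin n × Fin n) := Finset.univ.filter
    (fun z => z.1 ≠ z.2 ∧ Essential f z.1 ∧ Essential f z.2)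
  obtain ⟨⟨b, a⟩, hz, hmax'⟩ := Finset.exists_max_image P
    (fun z => (EssSet (ident f z.1 z.2)).card)
    ⟨(p0, q0), by simp [P, hpq0, mem_EssSet.1 hp0, mem_EssSet.1 hq0]⟩
  simp only [P, Finset.mem_filter, Finset.mem_univ, true_and] at hz hmax'
  obtain ⟨hba, hb, ha⟩ := hz
  have hmax : ∀ i j, i ≠ j → Essential f i → Essential f j →
      (EssSet (ident f i j)).card ≤ (EssSet (ident f b a)).card :=
    fun i j hij hi hj => hmax' (i, j) ⟨hij, hi, hj⟩
  by_cases hI : ∃ i j, i ≠ j ∧ Essential f i ∧ Essential f j ∧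
      (EssSet (ident f i j)).card = (EssSet (ident f b a)).card ∧ Essential (ident f i j) j
  · obtain ⟨i, j, hij, hi, hj, hc, he⟩ := hI
    obtain ⟨T, hT, hR⟩ := caseI hj hi hij.symm h4 hg he (by rw [hc]; exact hmax)
    exact sep_quasi (by omega) hT hR hM hME
  · push Not at hI
    rcases Nat.eq_zero_or_pos (EssSet (ident f b a)).card with h0 | hpos
    · refine sep_quasi (T := fun _ => f 0) (by omega) ?_ ?_ hM hME
      · have : EssSet (fun _ : Fin n → ZMod k => f 0) = ∅ := by
          ext i
          rw [mem_EssSet]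
          simp [Essential]
        rw [this]; simp; omega
      · rintro x ⟨i, j, hij, hi, hj, hx⟩
        rw [← ident_eq (f := f) hx, ← ident_eq (f := f) (i := i) (j := j) (x := 0) rfl]
        apply dep
        intro w hw
        have h1 := hmax i j hij hi hj
        have : 0 < (EssSet (ident f i j)).card := Finset.card_pos.2 ⟨w, mem_EssSet.2 hw⟩
        omega
    · have hall := caseII_all hpos hmax hI ha hb hba.symm rfl
      obtain ⟨t, ht⟩ := Finset.card_pos.1 hpos
      rw [mem_EssSet] at ht
      have htE := ident_sub ha ht
      obtain ⟨x, y, hxy, hne⟩ := ht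
      refine sep_sym hall htE (x := Function.update x b (x a)) (y := Function.update y b (y a))
        ⟨b, a, hba, hb, ha, by simp [hba.symm]⟩ ⟨b, a, hba, hb, ha, by simp [hba.symm]⟩ ?_ hne hM hME
      have hta : t ≠ a := by
        rintro rfl
        exact hall b t hba hb ha ⟨x, y, hxy, hne⟩
      intro w hw
      have := hxy w hw
      have := hxy a hta.symm
      simp only [Function.update_apply]
      grind

lemma gap_bound {f : (Fin n → ZMod k) → ZMod k} (hgap : 2 ≤ gap f) :
    2 ≤ (EssSet f).card ∧ ∀ i j, i ≠ j → Essential f i → Essential f j →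
      (EssSet (ident f i j)).card + 2 ≤ (EssSet f).card := by
  unfold gap at hgap
  rw [ess_eq_card] at hgap
  refine ⟨by omega, ?_⟩
  intro i j hij hi hj
  have hle : (EssSet (ident f i j)).card ≤ sSup {m | ∃ h, SimpleMinor f h ∧ m = ess h} := by
    apply le_csSup
    · refine ⟨n, ?_⟩
      rintro m ⟨h, -, rfl⟩
      rw [ess_eq_card]
      exact (Finset.card_le_univ _).trans (by simp)
    · exact ⟨ident f i j, ⟨i, j, hij, hi, hj, rfl⟩, (ess_eq_card _).symm⟩
  omega

end helpers

/-- If `f` has non-trivial essential arity gap, then every non-empty set of essential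
variables of `f` is separable in `f`. -/
theorem stmt_6 {n k : ℕ} (hk : 2 ≤ k) (f : (Fin n → ZMod k) → ZMod k)
    (hgap : 2 ≤ gap f) :
    ∀ M : Set (Fin n), M.Nonempty → M ⊆ {i | Essential f i} → Separable f M := by
  intro M hM hME
  have hME' : ∀ i ∈ M, Essential f i := fun i hi => hME hi
  obtain ⟨h2, hg⟩ := gap_bound hgap
  by_cases h4 : 4 ≤ (EssSet f).card
  · exact sep_four h4 hg hM hME'
  by_cases hEM : {i | Essential f i} ⊆ M
  · refine ⟨hM, ∅, 0, ?_⟩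
    have : restrictF f ∅ 0 = f := by
      funext x
      simp [restrictF]
    rw [this]
    exact Set.Subset.antisymm hEM hME
  obtain ⟨r, hr, hrM⟩ := Set.not_subset.1 hEM
  have hr' : Essential f r := hr
  obtain ⟨p, hp⟩ := hM
  by_cases hone : ∀ q ∈ M, q = p
  · obtain ⟨a, b, hab, hne⟩ := hME' p hp
    refine sep_of ⟨p, hp⟩ a ?_
    intro i hi
    rw [hone i hi]
    exact ⟨a, b, fun _ _ => rfl, hab, hne⟩
  push Not at hone
  obtain ⟨q, hq, hqp⟩ := hone
  have hpr : p ≠ r := by rintro rfl; exact hrM hp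
  have hqr : q ≠ r := by rintro rfl; exact hrM hq
  have hsub : ({p, q, r} : Finset (Fin n)) ⊆ EssSet f := by
    intro i hi
    simp only [Finset.mem_insert, Finset.mem_singleton] at hi
    rw [mem_EssSet]
    rcases hi with rfl | rfl | rfl
    · exact hME' _ hp
    · exact hME' _ hq
    · exact hr'
  have h3 : ({p, q, r} : Finset (Fin n)).card = 3 := by
    rw [Finset.card_eq_three]
    exact ⟨p, q, r, hqp.symm, hpr, hqr, rfl⟩
  have heq := Finset.eq_of_subset_of_card_le hsub (by omega)
  have hE : ∀ i, Essential f i ↔ i = p ∨ i = q ∨ i = r := by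
    intro i
    rw [← mem_EssSet, ← heq]
    simp
  have hMe : M = {p, q} := by
    ext i
    simp only [Set.mem_insert_iff, Set.mem_singleton_iff]
    constructor
    · intro hi
      rcases (hE i).1 (hME' i hi) with h | h | h
      · exact Or.inl h
      · exact Or.inr h
      · subst h; exact absurd hi hrM
    · rintro (rfl | rfl) <;> assumption
  rw [hMe]
  apply sep_three hqp.symm hpr hqr hE
  have := hg r p hpr.symm hr' (hME' p hp)
  rw [← heq, h3] at this
  omega
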